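/- arXiv:2204.04624 — 3 statements merged into one kernel-verified Lean document; each statement's English description precedes it below -/
import Mathlib

section
/- Let q ≥ 3 be an integer and p_1, p_2, ..., p_ℓ distinct primes with gcd(q, p_1 p_2 ⋯ p_ℓ) = 1. Then there exists an integer n_0 ≥ 2 such that for all k_1, k_2, ..., k_ℓ ≥ n_0, the multiplicative order of q modulo p_1^{k_1} p_2^{k_2} ⋯ p_ℓ^{k_ℓ} equals p_1^{k_1 - n_0} p_2^{k_2 - n_0} ⋯ p_ℓ^{k_ℓ - n_0} times the multiplicative order of q modulo (p_1 p_2 ⋯ p_ℓ)^{n_0}. -/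
/-- Lifting the exponent, uniformly in the prime, for a base congruent to `1` modulo `p ^ 2`. -/
theorem emultiplicity_pow_sub_one_of_sq_dvd {p : ℕ} (hp : p.Prime) {x : ℤ}
    (hx : (p : ℤ) ^ 2 ∣ x - 1) (m : ℕ) :
    emultiplicity (p : ℤ) (x ^ m - 1) = emultiplicity (p : ℤ) (x - 1) + emultiplicity p m := by
  have hdvd : (p : ℤ) ∣ x - 1 := (dvd_pow_self _ two_ne_zero).trans hx
  have hndvd : ¬ (p : ℤ) ∣ x := fun h =>
    (Nat.prime_iff_prime_int.mp hp).not_dvd_one (by simpa using dvd_sub h hdvd)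
  rcases hp.eq_two_or_odd' with rfl | hodd
  · have h := Int.two_pow_sub_pow' (y := 1) m (by simpa using hx) (by simpa using hndvd)
    rw [one_pow] at h
    rw [← Int.natCast_emultiplicity 2 m]
    exact_mod_cast h
  · simpa using Int.emultiplicity_pow_sub_pow hp hodd hdvd hndvd m

theorem pow_dvd_pow_sub_one_iff {p : ℕ} (hp : p.Prime) {x : ℤ}
    (hx : (p : ℤ) ^ 2 ∣ x - 1) {c k : ℕ} (hc : emultiplicity (p : ℤ) (x - 1) = c)
    (hk : c ≤ k) (m : ℕ) :
    (p : ℤ) ^ k ∣ x ^ m - 1 ↔ p ^ (k - c) ∣ m := by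
  rw [pow_dvd_iff_le_emultiplicity, pow_dvd_iff_le_emultiplicity,
    emultiplicity_pow_sub_one_of_sq_dvd hp hx, hc]
  obtain ⟨d, rfl⟩ := Nat.exists_eq_add_of_le hk
  rw [Nat.add_sub_cancel_left, Nat.cast_add]
  exact ENat.add_le_add_iff_left (ENat.natCast_ne_top c)

theorem ZMod.orderOf_natCast_dvd_iff (q N n : ℕ) :
    orderOf (q : ZMod N) ∣ n ↔ (N : ℤ) ∣ (q : ℤ) ^ n - 1 := by
  rw [orderOf_dvd_iff_pow_eq_one, ← ZMod.intCast_zmod_eq_zero_iff_dvd, ← sub_eq_zero]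
  push_cast
  rfl

theorem prod_prime_pow_dvd_iff {ι : Type*} [Fintype ι] {p : ι → ℕ} (hp : ∀ j, (p j).Prime)
    (hinj : Function.Injective p) (k : ι → ℕ) (a : ℕ) :
    ∏ j, p j ^ k j ∣ a ↔ ∀ j, p j ^ k j ∣ a := by
  refine ⟨fun h j => (Finset.dvd_prod_of_mem _ (Finset.mem_univ j)).trans h, fun h => ?_⟩
  refine Fintype.prod_dvd_of_isRelPrime (fun i j hij => ?_) h
  exact Nat.coprime_iff_isRelPrime.mp
    (Nat.coprime_pow_primes _ _ (hp i) (hp j) (hinj.ne hij))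

theorem intCast_prod_prime_pow_dvd_iff {ι : Type*} [Fintype ι] {p : ι → ℕ}
    (hp : ∀ j, (p j).Prime) (hinj : Function.Injective p) (k : ι → ℕ) (a : ℤ) :
    ((∏ j, p j ^ k j : ℕ) : ℤ) ∣ a ↔ ∀ j, (p j : ℤ) ^ k j ∣ a := by
  rw [Int.natCast_dvd, prod_prime_pow_dvd_iff hp hinj]
  exact forall_congr' fun j => by rw [← Int.natCast_dvd, Nat.cast_pow]

/-- With `c j` the exponent of `p j` in `q ^ M - 1`, where `M` is the order of `q` modulo
`∏ j, p j ^ 2`, the order modulo `∏ j, p j ^ k j` is explicit as soon as `c ≤ k`. -/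
theorem orderOf_natCast_prod_prime_pow {ι : Type*} [Fintype ι] {p : ι → ℕ}
    (hp : ∀ j, (p j).Prime) (hinj : Function.Injective p) {q : ℕ} {c k : ι → ℕ}
    (hc : ∀ j, emultiplicity (p j : ℤ)
      ((q : ℤ) ^ orderOf (q : ZMod (∏ j, p j ^ 2)) - 1) = c j)
    (hk : ∀ j, c j ≤ k j) :
    orderOf (q : ZMod (∏ j, p j ^ k j)) =
      orderOf (q : ZMod (∏ j, p j ^ 2)) * ∏ j, p j ^ (k j - c j) := by
  set M := orderOf (q : ZMod (∏ j, p j ^ 2)) with hM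
  have hsq : ∀ j, (p j : ℤ) ^ 2 ∣ (q : ℤ) ^ M - 1 :=
    (intCast_prod_prime_pow_dvd_iff hp hinj (fun _ => 2) _).mp
      ((ZMod.orderOf_natCast_dvd_iff q _ M).mp dvd_rfl)
  have hc2 : ∀ j, 2 ≤ c j := fun j => by
    have h := pow_dvd_iff_le_emultiplicity.mp (hsq j)
    rw [hc j] at h
    exact_mod_cast h
  have key (m : ℕ) : orderOf (q : ZMod (∏ j, p j ^ k j)) ∣ M * m ↔
      ∏ j, p j ^ (k j - c j) ∣ m := by
    rw [ZMod.orderOf_natCast_dvd_iff, intCast_prod_prime_pow_dvd_iff hp hinj,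
      prod_prime_pow_dvd_iff hp hinj (fun j => k j - c j), pow_mul]
    exact forall_congr' fun j => pow_dvd_pow_sub_one_iff (hp j) (hsq j) (hc j) (hk j) m
  refine Nat.dvd_antisymm ((key _).mpr dvd_rfl) ?_
  have hMdvd : M ∣ orderOf (q : ZMod (∏ j, p j ^ k j)) := by
    rw [hM, ZMod.orderOf_natCast_dvd_iff]
    refine dvd_trans ?_ ((ZMod.orderOf_natCast_dvd_iff q (∏ j, p j ^ k j) _).mp dvd_rfl)
    exact_mod_cast Finset.prod_dvd_prod_of_dvd _ _
      fun j _ => pow_dvd_pow (p j) ((hc2 j).trans (hk j))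
  obtain ⟨m, hm⟩ := hMdvd
  rw [hm]
  exact mul_dvd_mul_left M ((key m).mp (by rw [hm]))

theorem ZMod.orderOf_natCast_pos {q N : ℕ} (hN : 0 < N) (h : q.Coprime N) :
    0 < orderOf (q : ZMod N) := by
  rw [orderOf_pos_iff, isOfFinOrder_iff_pow_eq_one]
  refine ⟨N.totient, Nat.totient_pos.mpr hN, ?_⟩
  have := (ZMod.natCast_eq_natCast_iff _ _ _).mpr (Nat.ModEq.pow_totient h)
  simpa using this

theorem stmt_7 (q ℓ : ℕ) (hq : 3 ≤ q) (p : Fin ℓ → ℕ) (hp : ∀ j, (p j).Prime)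
    (hinj : Function.Injective p) (hgcd : Nat.gcd q (∏ j, p j) = 1) :
    ∃ n0 : ℕ, 2 ≤ n0 ∧ ∀ k : Fin ℓ → ℕ, (∀ j, n0 ≤ k j) →
      orderOf (q : ZMod (∏ j, p j ^ (k j))) =
        (∏ j, p j ^ (k j - n0)) * orderOf (q : ZMod ((∏ j, p j) ^ n0)) := by
  have hpos : 0 < orderOf (q : ZMod (∏ j, p j ^ 2)) := by
    refine ZMod.orderOf_natCast_pos (Finset.prod_pos fun j _ => pow_pos (hp j).pos 2) ?_
    rw [Finset.prod_pow]
    exact Nat.Coprime.pow_right 2 hgcd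
  have hfin (j : Fin ℓ) : FiniteMultiplicity (p j : ℤ)
      ((q : ℤ) ^ orderOf (q : ZMod (∏ j, p j ^ 2)) - 1) := by
    refine Int.finiteMultiplicity_iff.mpr ⟨by simpa using (hp j).ne_one, ?_⟩
    have : (1 : ℤ) < (q : ℤ) ^ orderOf (q : ZMod (∏ j, p j ^ 2)) :=
      one_lt_pow₀ (by exact_mod_cast (by omega : 1 < q)) hpos.ne'
    omega
  choose c hc using fun j => ENat.ne_top_iff_exists.mp
    (finiteMultiplicity_iff_emultiplicity_ne_top.mp (hfin j))
  have hle (j : Fin ℓ) : c j ≤ 2 + ∑ i, c i :=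
    (Finset.single_le_sum (fun _ _ => Nat.zero_le _) (Finset.mem_univ j)).trans
      (Nat.le_add_left _ _)
  refine ⟨2 + ∑ i, c i, Nat.le_add_right _ _, fun k hk => ?_⟩
  rw [← Finset.prod_pow,
    orderOf_natCast_prod_prime_pow hp hinj (fun j => (hc j).symm)
      (fun j => (hle j).trans (hk j)),
    orderOf_natCast_prod_prime_pow hp hinj (k := fun _ => 2 + ∑ i, c i)
      (fun j => (hc j).symm) hle,
    mul_left_comm, ← Finset.prod_mul_distrib]
  congr 1
  refine Finset.prod_congr rfl fun j _ => ?_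
  rw [← pow_add, Nat.sub_add_sub_cancel (hk j) (hle j)]
end

section
/- Let q ≥ 3 be an integer and A a subset of {0,1,...,q-1} with 1 < #A < q, and let K(q,A) = { Σ_{i=1}^∞ d_i/q^i : d_i ∈ A for all i ∈ ℕ }. Let r = s/t ∈ (0,1) be a rational with gcd(s,t) = 1. If t has a prime factor that does not divide q, then for any positive rational α the set { k ∈ ℕ : α r^k ∈ K(q,A) } is finite. -/
/-- `K q A` is the set of reals `∑_{i=1}^∞ d_i / q^i` with all digits `d_i ∈ A`. -/
def K (q : ℕ) (A : Finset ℕ) : Set ℝ :=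
  {x | ∃ d : ℕ → ℕ, (∀ i, d i ∈ A) ∧ x = ∑' i : ℕ, (d i : ℝ) / (q : ℝ) ^ (i + 1)}

section DigitSets

variable {q : ℕ} {A : Finset ℕ}

theorem summable_digits (hq : 3 ≤ q) (hAq : A ⊆ Finset.range q) {d : ℕ → ℕ}
    (hd : ∀ i, d i ∈ A) : Summable fun i : ℕ => (d i : ℝ) / (q : ℝ) ^ (i + 1) := by
  have hq' : (3 : ℝ) ≤ q := by exact_mod_cast hq
  have hs : Summable fun i : ℕ => ((q : ℝ)⁻¹) ^ i :=
    summable_geometric_of_lt_one (by positivity) (inv_lt_one_of_one_lt₀ (by linarith))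
  refine Summable.of_nonneg_of_le (fun i => by positivity) (fun i => ?_) hs
  have h : (d i : ℝ) ≤ q := by exact_mod_cast (Finset.mem_range.1 (hAq (hd i))).le
  rw [inv_pow, pow_succ, div_le_iff₀ (by positivity), ← mul_assoc,
    inv_mul_cancel₀ (by positivity), one_mul]
  exact h

theorem K_subset_Icc (hq : 3 ≤ q) (hAq : A ⊆ Finset.range q) {x : ℝ} (hx : x ∈ K q A) :
    0 ≤ x ∧ x ≤ 1 := by
  obtain ⟨d, hd, rfl⟩ := hx
  have hq' : (3 : ℝ) ≤ q := by exact_mod_cast hq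
  refine ⟨tsum_nonneg fun i => by positivity, ?_⟩
  have hlt : (q : ℝ)⁻¹ < 1 := inv_lt_one_of_one_lt₀ (by linarith)
  have hs := (hasSum_geometric_of_lt_one (by positivity) hlt).mul_left (((q : ℝ) - 1) * (q : ℝ)⁻¹)
  have hv : ((q : ℝ) - 1) * (q : ℝ)⁻¹ * (1 - (q : ℝ)⁻¹)⁻¹ = 1 := by
    have h1 : (q : ℝ) ≠ 0 := by linarith
    have h2 : (q : ℝ) - 1 ≠ 0 := by linarith
    have h3 : 1 - (q : ℝ)⁻¹ = ((q : ℝ) - 1) * (q : ℝ)⁻¹ := by field_simp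
    rw [h3]
    exact mul_inv_cancel₀ (mul_ne_zero h2 (inv_ne_zero h1))
  rw [hv] at hs
  rw [← hs.tsum_eq]
  refine (summable_digits hq hAq hd).tsum_le_tsum (fun i => ?_) hs.summable
  have h : (d i : ℝ) + 1 ≤ q := by exact_mod_cast Finset.mem_range.1 (hAq (hd i))
  rw [div_eq_mul_inv, pow_succ, mul_inv_rev, ← mul_assoc, inv_pow]
  gcongr
  linarith

theorem exists_digit_shift_mem_K (hq : 3 ≤ q) (hAq : A ⊆ Finset.range q) {x : ℝ}
    (hx : x ∈ K q A) : ∃ d ∈ A, (q : ℝ) * x - d ∈ K q A := by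
  obtain ⟨d, hd, rfl⟩ := hx
  refine ⟨d 0, hd 0, fun i => d (i + 1), fun i => hd _, ?_⟩
  have hq0 : (q : ℝ) ≠ 0 := by positivity
  rw [(summable_digits hq hAq hd).tsum_eq_zero_add, mul_add, ← tsum_mul_left]
  have h0 : (q : ℝ) * ((d 0 : ℝ) / (q : ℝ) ^ (0 + 1)) = d 0 := by rw [zero_add, pow_one]; field_simp
  rw [h0, add_sub_cancel_left]
  refine tsum_congr fun i => ?_
  rw [pow_succ _ (i + 1)]
  field_simp

theorem exists_int_pow_mul_sub_mem_K (hq : 3 ≤ q) (hAq : A ⊆ Finset.range q) {x : ℝ}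
    (hx : x ∈ K q A) (n : ℕ) : ∃ j : ℤ, (q : ℝ) ^ n * x - j ∈ K q A := by
  induction n with
  | zero => exact ⟨0, by simpa using hx⟩
  | succ n ih =>
    obtain ⟨j, hj⟩ := ih
    obtain ⟨d, -, hd⟩ := exists_digit_shift_mem_K hq hAq hj
    refine ⟨q * j + d, ?_⟩
    convert hd using 1
    push_cast
    ring

/-- Points of `K q A + ℤ` avoid the cylinder of a missing digit. -/
theorem sub_int_notMem_K (hq : 3 ≤ q) (hAq : A ⊆ Finset.range q) {a : ℕ} (haq : a < q)
    (ha : a ∉ A) {y : ℝ} (h1 : (a : ℝ) < q * y) (h2 : q * y < a + 1) (j : ℤ) :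
    y - j ∉ K q A := by
  intro hy
  have hq' : (3 : ℝ) ≤ q := by exact_mod_cast hq
  have haq' : (a : ℝ) + 1 ≤ q := by exact_mod_cast haq
  obtain ⟨hl, hu⟩ := K_subset_Icc hq hAq hy
  have hy0 : 0 < y := by
    by_contra! h
    nlinarith [(Nat.cast_nonneg a : (0 : ℝ) ≤ a)]
  have hy1 : y < 1 := by
    by_contra! h
    nlinarith
  have hj0 : j = 0 := by
    have h3 : (j : ℝ) < (1 : ℤ) := by push_cast; linarith
    have h4 : ((-1 : ℤ) : ℝ) < j := by push_cast; linarith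
    have h5 := Int.cast_lt.1 h3
    have h6 := Int.cast_lt.1 h4
    omega
  subst hj0
  obtain ⟨d, hd, hdK⟩ := exists_digit_shift_mem_K hq hAq hy
  obtain ⟨hl', hu'⟩ := K_subset_Icc hq hAq hdK
  push_cast at hl' hu'
  have h3 : (d : ℝ) < (a + 1 : ℕ) := by push_cast; linarith
  have h4 : (a : ℝ) < (d + 1 : ℕ) := by push_cast; linarith
  have h5 := Nat.cast_lt.1 h3
  have h6 := Nat.cast_lt.1 h4
  have : d = a := by omega
  exact ha (this ▸ hd)

/-- If `(Y - 1) * z = u / C` and `C ∣ Y - 1`, then `Y ^ j * z` is `z + j * u / C` modulo `1`. -/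
theorem exists_int_pow_mul_eq {Y u C : ℤ} (hC : C ≠ 0) (hY : C ∣ Y - 1) {z : ℝ}
    (hz : ((Y : ℝ) - 1) * z = u / C) (j : ℕ) :
    ∃ i : ℤ, (Y : ℝ) ^ j * z = z + j * u / C + i := by
  obtain ⟨g, hg⟩ := hY
  have hC' : (C : ℝ) ≠ 0 := by exact_mod_cast hC
  have hg' : (Y : ℝ) = 1 + C * g := by
    have : Y = 1 + C * g := by linarith
    exact_mod_cast this
  induction j with
  | zero => exact ⟨0, by simp⟩
  | succ j ih =>
    obtain ⟨i, hi⟩ := ih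
    refine ⟨j * g * u + Y * i, ?_⟩
    have h : (Y : ℝ) * z = z + u / C := by linarith
    have h' : (Y : ℝ) * (j * u / C) = j * u / C + j * g * u := by
      rw [hg']; field_simp
    rw [pow_succ', mul_assoc, hi, mul_add, mul_add, h, h']
    push_cast
    ring

theorem notMem_K_of_pow_sub_one_mul_eq (hq : 3 ≤ q) (hAq : A ⊆ Finset.range q) {a : ℕ}
    (haq : a < q) (ha : a ∉ A) {C n m : ℕ} {u : ℤ} (hC : q < C)
    (hY : (C : ℤ) ∣ (q : ℤ) ^ n - 1) (hu : IsCoprime u (C : ℤ)) {x : ℝ}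
    (hz : ((q : ℝ) ^ n - 1) * ((q : ℝ) ^ m * x) = u / C) : x ∉ K q A := by
  intro hx
  have hq' : (3 : ℝ) ≤ q := by exact_mod_cast hq
  have hC' : (q : ℝ) < C := by exact_mod_cast hC
  have hC0 : (C : ℤ) ≠ 0 := by omega
  set z := (q : ℝ) ^ m * x with hzdef
  obtain ⟨J, hJ1, hJ2⟩ : ∃ J : ℤ, (a : ℝ) < q * (z + J / C) ∧ q * (z + J / C) < a + 1 := by
    set w := (C : ℝ) * (a / q - z) with hw
    have hwf : ∀ J : ℝ, (q : ℝ) * (z + J / C) = a + q * (J - w) / C := by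
      intro J
      have h1 : (q : ℝ) ≠ 0 := by linarith
      have h2 : (C : ℝ) ≠ 0 := by linarith
      rw [hw]
      field_simp
      ring
    have hl := Int.lt_floor_add_one w
    have hu := Int.floor_le w
    refine ⟨⌊w⌋ + 1, ?_, ?_⟩ <;> rw [hwf] <;> push_cast
    · exact lt_add_of_pos_right _
        (div_pos (mul_pos (by linarith) (by linarith)) (by linarith))
    · rw [add_lt_add_iff_left, div_lt_one (by linarith)]
      nlinarith
  obtain ⟨v, w, hvw⟩ := hu
  obtain ⟨j, hj⟩ : ∃ j : ℕ, (j : ℤ) = (J * v) % C :=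
    ⟨((J * v) % C).toNat, Int.toNat_of_nonneg (Int.emod_nonneg _ hC0)⟩
  obtain ⟨g, hg⟩ : ∃ g : ℤ, (j : ℤ) * u = J + C * g := by
    refine ⟨-(J * w) - (J * v) / C * u, ?_⟩
    have h := Int.emod_add_mul_ediv (J * v) C
    rw [← hj] at h
    have h' : (j : ℤ) = J * v - C * (J * v / C) := by linarith
    rw [h']
    linear_combination J * hvw
  obtain ⟨i, hi⟩ := exists_int_pow_mul_eq (Y := (q : ℤ) ^ n) (u := u) hC0 hY (z := z)
    (by push_cast; exact hz) j
  obtain ⟨l, hl⟩ := exists_int_pow_mul_sub_mem_K hq hAq hx (n * j + m)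
  refine sub_int_notMem_K hq hAq haq ha hJ1 hJ2 (l - g - i) ?_
  convert hl using 1
  have hg' : (j : ℝ) * u = J + C * g := by exact_mod_cast hg
  have hCr : (C : ℝ) ≠ 0 := by linarith
  push_cast at hi
  rw [pow_add, mul_assoc, ← hzdef, pow_mul, hi, hg']
  push_cast
  field_simp
  ring

end DigitSets

theorem exists_pow_one_add_eq (x : ℤ) (m : ℕ) : ∃ w : ℤ, (1 + x) ^ m = 1 + m * x + w * x ^ 2 := by
  obtain ⟨w, hw⟩ := Polynomial.powAddExpansion (1 : ℤ) x m
  exact ⟨w, by simpa using hw⟩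

theorem exists_pow_eq_of_not_dvd {c : ℕ} (hc : c.Prime) {v m : ℕ} (hv : 2 ≤ v)
    {u : ℤ} (hu : ¬ (c : ℤ) ∣ u)
    (hm : ¬ c ∣ m) : ∃ u' : ℤ, ¬ (c : ℤ) ∣ u' ∧
      (1 + (c : ℤ) ^ v * u) ^ m = 1 + (c : ℤ) ^ v * u' := by
  obtain ⟨w, hw⟩ := exists_pow_one_add_eq ((c : ℤ) ^ v * u) m
  obtain ⟨v, rfl⟩ := Nat.exists_eq_add_of_le hv
  refine ⟨m * u + c * (c ^ (v + 1) * w * u ^ 2), fun h => ?_, by rw [hw]; ring⟩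
  rw [Int.dvd_add_left (dvd_mul_right _ _)] at h
  rcases (Nat.prime_iff_prime_int.1 hc).dvd_or_dvd h with h | h
  · exact hm (by exact_mod_cast h)
  · exact hu h

theorem exists_pow_self_pow_eq {c v : ℕ} (hv : 2 ≤ v) {u : ℤ} (hu : ¬ (c : ℤ) ∣ u) (i : ℕ) :
    ∃ u' : ℤ, ¬ (c : ℤ) ∣ u' ∧
      (1 + (c : ℤ) ^ v * u) ^ c ^ i = 1 + (c : ℤ) ^ (v + i) * u' := by
  induction i with
  | zero => exact ⟨u, hu, by simp⟩
  | succ i ih =>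
    obtain ⟨u', hu', h⟩ := ih
    obtain ⟨w, hw⟩ := exists_pow_one_add_eq ((c : ℤ) ^ (v + i) * u') c
    obtain ⟨v, rfl⟩ := Nat.exists_eq_add_of_le hv
    refine ⟨u' + c * (c ^ (v + i) * w * u' ^ 2), fun h' => ?_,
      by rw [pow_succ, pow_mul, h, hw]; ring⟩
    rw [Int.dvd_add_left (dvd_mul_right _ _)] at h'
    exact hu' h'

theorem exists_dvd_pow_mul_pow_sub_one (q N : ℕ) (hN : N ≠ 0) :
    ∃ m n : ℕ, 0 < n ∧ (N : ℤ) ∣ (q : ℤ) ^ m * ((q : ℤ) ^ n - 1) := by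
  have : NeZero N := ⟨hN⟩
  obtain ⟨i, j, hne, h⟩ := Finite.exists_ne_map_eq_of_infinite fun n : ℕ => (q : ZMod N) ^ n
  wlog hij : i < j generalizing i j
  · exact this j i hne.symm h.symm (by omega)
  refine ⟨i, j - i, by omega, ?_⟩
  rw [mul_sub, ← pow_add, Nat.add_sub_cancel' hij.le, mul_one, ← ZMod.intCast_zmod_eq_zero_iff_dvd]
  push_cast
  exact sub_eq_zero.2 h.symm

theorem exists_pow_sub_one_mul_eq {q c : ℕ} (hq : 3 ≤ q) (hc : c.Prime) (hcq : ¬ c ∣ q)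
    {a b s t : ℕ} (ha : a ≠ 0) (hb : b ≠ 0) (ht : t ≠ 0) (hct : c ∣ t) (hcs : ¬ c ∣ s) (h : ℕ) :
    ∃ k₀ : ℕ, ∀ k ≥ k₀, ∃ (m n : ℕ) (u : ℤ), ((c ^ h : ℕ) : ℤ) ∣ (q : ℤ) ^ n - 1 ∧
      IsCoprime u ((c ^ h : ℕ) : ℤ) ∧
      ((q : ℝ) ^ n - 1) * ((q : ℝ) ^ m * ((a / b) * (s / t) ^ k)) = u / (c ^ h : ℕ) := by
  have hcp : Prime (c : ℤ) := Nat.prime_iff_prime_int.1 hc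
  obtain ⟨a1, a', ha', rfl⟩ := Nat.exists_eq_pow_mul_and_not_dvd ha c hc.ne_one
  obtain ⟨b1, b', hb', rfl⟩ := Nat.exists_eq_pow_mul_and_not_dvd hb c hc.ne_one
  obtain ⟨τ, t', ht', rfl⟩ := Nat.exists_eq_pow_mul_and_not_dvd ht c hc.ne_one
  have hτ : 1 ≤ τ := by
    rcases Nat.eq_zero_or_pos τ with rfl | hτ
    · exact absurd (by simpa using hct) ht'
    · exact hτ
  have hb0 : b' ≠ 0 := fun h => hb' (h ▸ dvd_zero c)
  have ht0 : t' ≠ 0 := fun h => ht' (h ▸ dvd_zero c)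
  have hcq' : ¬ (c : ℤ) ∣ q := by exact_mod_cast hcq
  obtain ⟨m, n, hn, hdvd⟩ := exists_dvd_pow_mul_pow_sub_one q (c ^ 2 * (b' * t'))
    (mul_ne_zero (pow_ne_zero _ hc.ne_zero) (mul_ne_zero hb0 ht0))
  have hcop : IsCoprime ((c : ℤ) ^ 2) ((q : ℤ) ^ m) :=
    ((hcp.coprime_iff_not_dvd).2 hcq').pow
  have hdvd1 : (c : ℤ) ^ 2 ∣ (q : ℤ) ^ n - 1 :=
    hcop.dvd_of_dvd_mul_left ((Dvd.intro _ (by push_cast; rfl)).trans hdvd)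
  have hdvd2 : ((b' * t' : ℕ) : ℤ) ∣ (q : ℤ) ^ m * ((q : ℤ) ^ n - 1) :=
    (Dvd.intro_left ((c : ℤ) ^ 2) (by push_cast; rfl)).trans hdvd
  obtain ⟨D, B, ⟨g, hg⟩, hB, hDB⟩ := exists_dvd_and_dvd_of_dvd_mul hdvd2
  push_cast at hDB
  have hcB : ¬ (c : ℤ) ∣ B := by
    intro h
    have h' : (c : ℤ) ∣ b' * t' := hDB ▸ h.mul_left D
    rcases hcp.dvd_or_dvd h' with h' | h'
    · exact hb' (by exact_mod_cast h')
    · exact ht' (by exact_mod_cast h')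
  have hcg : ¬ (c : ℤ) ∣ g := fun h => hcq' (hcp.dvd_of_dvd_pow (hg ▸ h.mul_left D))
  have hq1 : 1 < q ^ n := Nat.one_lt_pow hn.ne' (by omega)
  obtain ⟨f, u₀, hu₀, hf⟩ :=
    Nat.exists_eq_pow_mul_and_not_dvd (n := q ^ n - 1) (by omega) c hc.ne_one
  have hqf : (q : ℤ) ^ n = 1 + (c : ℤ) ^ f * (u₀ : ℤ) := by
    have : q ^ n = 1 + c ^ f * u₀ := by omega
    exact_mod_cast this
  have hu₀' : ¬ (c : ℤ) ∣ u₀ := by exact_mod_cast hu₀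
  have hf2 : 2 ≤ f := by
    rw [hqf, add_sub_cancel_left] at hdvd1
    have h1 := hcp.pow_dvd_of_dvd_mul_right 2 hu₀' hdvd1
    exact (Nat.pow_dvd_pow_iff_le_right hc.one_lt).1 (by exact_mod_cast h1)
  refine ⟨a1 + 2 * h + f + 1, fun k hk => ?_⟩
  have hk1 : k ≤ τ * k := Nat.le_mul_of_pos_left k hτ
  obtain ⟨i, hi⟩ : ∃ i, τ * k + b1 = a1 + h + f + i := ⟨τ * k + b1 - (a1 + h + f), by omega⟩
  have hcBk : ¬ c ∣ B.natAbs ^ k := fun h =>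
    hcB (Int.natCast_dvd.2 (hc.dvd_of_dvd_pow h))
  obtain ⟨u₁, hu₁, hqu₁⟩ := exists_pow_eq_of_not_dvd hc hf2 hu₀' hcBk
  obtain ⟨u₂, hu₂, hqu₂⟩ := exists_pow_self_pow_eq hf2 hu₁ i
  have hY : (q : ℤ) ^ (n * B.natAbs ^ k * c ^ i) = 1 + (c : ℤ) ^ (f + i) * u₂ := by
    rw [pow_mul, pow_mul, hqf, hqu₁, hqu₂]
  have hBY : B ^ k ∣ (c : ℤ) ^ (f + i) * u₂ := by
    have h1 : ((B.natAbs : ℕ) : ℤ) ∣ (q : ℤ) ^ n - 1 := Int.natAbs_dvd.2 hB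
    have h2 := (pow_dvd_pow _ k.le_succ).trans (dvd_sub_pow_of_dvd_sub h1 k)
    have h3 : B ^ k ∣ ((B.natAbs : ℕ) : ℤ) ^ k := pow_dvd_pow_of_dvd (Int.dvd_natAbs.2 dvd_rfl) k
    have h4 := sub_dvd_pow_sub_pow (((q : ℤ) ^ n) ^ B.natAbs ^ k) (1 ^ B.natAbs ^ k) (c ^ i)
    have h5 := (h3.trans h2).trans h4
    rwa [← pow_mul, ← pow_mul, ← mul_assoc, hY, one_pow, one_pow, add_sub_cancel_left] at h5
  have hcopB : IsCoprime (B ^ k) ((c : ℤ) ^ (f + i)) :=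
    ((hcp.coprime_iff_not_dvd).2 hcB).symm.pow
  obtain ⟨w, rfl⟩ := hcopB.dvd_of_dvd_mul_left hBY
  have hcw : ¬ (c : ℤ) ∣ w := fun h => hu₂ (h.mul_left _)
  obtain ⟨l, rfl⟩ : ∃ l, k = l + 1 := ⟨k - 1, by omega⟩
  refine ⟨m * (l + 1), n * B.natAbs ^ (l + 1) * c ^ i,
    w * g ^ (l + 1) * a' * s ^ (l + 1) * b' ^ l, ?_, ?_, ?_⟩
  · rw [hY, add_sub_cancel_left]
    push_cast
    exact (pow_dvd_pow _ (by omega)).mul_right _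
  · push_cast
    refine IsCoprime.pow_right (((hcp.coprime_iff_not_dvd).2 fun hd => ?_).symm)
    have hca : ¬ (c : ℤ) ∣ a' := by exact_mod_cast ha'
    have hcb : ¬ (c : ℤ) ∣ b' := by exact_mod_cast hb'
    have hcs' : ¬ (c : ℤ) ∣ s := by exact_mod_cast hcs
    rcases hcp.dvd_or_dvd hd with hd | hd
    · rcases hcp.dvd_or_dvd hd with hd | hd
      · rcases hcp.dvd_or_dvd hd with hd | hd
        · rcases hcp.dvd_or_dvd hd with hd | hd
          · exact hcw hd
          · exact hcg (hcp.dvd_of_dvd_pow hd)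
        · exact hca hd
      · exact hcs' (hcp.dvd_of_dvd_pow hd)
    · exact hcb (hcp.dvd_of_dvd_pow hd)
  · have hYr : (q : ℝ) ^ (n * B.natAbs ^ (l + 1) * c ^ i) - 1
        = (c : ℝ) ^ (f + i) * ((B : ℝ) ^ (l + 1) * w) := by
      rw [sub_eq_iff_eq_add']
      exact_mod_cast hY
    have hgr : (q : ℝ) ^ m = D * g := by exact_mod_cast hg
    have hDBr : (b' : ℝ) * t' = D * B := by exact_mod_cast hDB
    have hcr : (c : ℝ) ≠ 0 := by exact_mod_cast hc.ne_zero
    have hbr : (b' : ℝ) ≠ 0 := by exact_mod_cast hb0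
    have htr : (t' : ℝ) ≠ 0 := by exact_mod_cast ht0
    have hir : (c : ℝ) ^ (τ * (l + 1)) * (c : ℝ) ^ b1
        = (c : ℝ) ^ a1 * (c : ℝ) ^ h * (c : ℝ) ^ (f + i) := by
      rw [← pow_add, ← pow_add, ← pow_add, hi, add_assoc (a1 + h)]
    have hpow : (b' : ℝ) ^ (l + 1) * (t' : ℝ) ^ (l + 1) = (D : ℝ) ^ (l + 1) * (B : ℝ) ^ (l + 1) := by
      rw [← mul_pow, hDBr, mul_pow]
    rw [hYr, pow_mul, hgr]
    push_cast
    rw [div_pow, mul_pow (_ ^ τ), ← pow_mul, mul_pow (D : ℝ), div_mul_div_comm,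
      ← mul_div_assoc, ← mul_div_assoc, div_eq_div_iff (by positivity) (by positivity)]
    linear_combination (-(w * g ^ (l + 1) * a' * s ^ (l + 1) * b' ^ (l + 1) * t' ^ (l + 1)) : ℝ) * hir
      - ((c : ℝ) ^ (f + i) * c ^ a1 * c ^ h * w * g ^ (l + 1) * a' * s ^ (l + 1)) * hpow

theorem stmt_11 (q : ℕ) (hq : 3 ≤ q) (A : Finset ℕ) (hAq : A ⊆ Finset.range q)
    (hA1 : 1 < A.card) (hA2 : A.card < q)
    (r : ℚ) (hr0 : 0 < r) (hr1 : r < 1)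
    (ht : ∃ c : ℕ, c.Prime ∧ c ∣ r.den ∧ ¬ c ∣ q)
    (α : ℚ) (hα : 0 < α) :
    {k : ℕ | 0 < k ∧ ((α * r ^ k : ℚ) : ℝ) ∈ K q A}.Finite := by
  obtain ⟨c, hc, hct, hcq⟩ := ht
  obtain ⟨a, haq, ha⟩ : ∃ a ∈ Finset.range q, a ∉ A :=
    Finset.exists_mem_notMem_of_card_lt_card (by simpa using hA2)
  have hcs : ¬ c ∣ r.num.natAbs := fun h =>
    hc.ne_one (Nat.eq_one_of_dvd_coprimes r.reduced h hct)
  have key : ∀ x : ℚ, 0 < x → (x : ℝ) = (x.num.natAbs : ℝ) / x.den := by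
    intro x hx
    rw [Nat.cast_natAbs, abs_of_pos (Rat.num_pos.2 hx)]
    exact Rat.cast_def x
  obtain ⟨k₀, hk₀⟩ := exists_pow_sub_one_mul_eq hq hc hcq (a := α.num.natAbs) (b := α.den)
    (s := r.num.natAbs) (by simpa using hα.ne') α.den_nz r.den_nz hct hcs q
  refine (Set.finite_lt_nat k₀).subset fun k ⟨_, hk⟩ => ?_
  by_contra hlt
  obtain ⟨m, n, u, h1, h2, h3⟩ := hk₀ k (not_lt.1 hlt)
  refine notMem_K_of_pow_sub_one_mul_eq hq hAq (Finset.mem_range.1 haq) ha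
    (Nat.lt_pow_self hc.one_lt) h1 h2 (m := m) ?_ hk
  push_cast
  rw [key α hα, key r hr0]
  exact_mod_cast h3
end

section
/- Let q ≥ 3 and p ≥ 2 be integers with gcd(p,q) = 1, and let m ∈ ℕ. Then there exists n_0 ∈ ℕ such that for all n ≥ n_0, every q-adic digit sequence (d_i)_{i≥1} with d_i ∈ {0,1,...,q-1} and p^{-n} = Σ_{i=1}^∞ d_i/q^i contains every block in {0,1,...,q-1}^m: for each word (w_1,...,w_m) ∈ {0,1,...,q-1}^m there is an index i with (d_i, d_{i+1}, ..., d_{i+m-1}) = (w_1,...,w_m). -/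
theorem exists_one_add_pow_eq (z : ℤ) (n : ℕ) :
    ∃ e : ℤ, (1 + z) ^ n = 1 + n * z + e * z ^ 2 := by
  obtain ⟨e, he⟩ := Polynomial.powAddExpansion 1 z n
  exact ⟨e, by simpa using he⟩

theorem exists_one_add_pow_pow_eq (p : ℕ) (g : ℤ) (n : ℕ) :
    ∃ c : ℤ, (1 + (p : ℤ) ^ 2 * g) ^ p ^ n = 1 + p ^ 2 * g * p ^ n * (1 + p * c) := by
  induction n with
  | zero => exact ⟨0, by simp⟩
  | succ n ih =>
    obtain ⟨c, hc⟩ := ih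
    obtain ⟨e, he⟩ := exists_one_add_pow_eq ((p : ℤ) ^ 2 * g * p ^ n * (1 + p * c)) p
    refine ⟨c + e * g * p ^ n * (1 + p * c) ^ 2, ?_⟩
    rw [pow_succ p n, pow_mul, hc, he]
    ring

/-- The powers of `1 + D` exhaust the residues congruent to `1` modulo `D`, modulo every power
of `p`, as soon as `p ^ 2 ∣ D`. -/
theorem exists_pow_eq_one_add_mul (p : ℕ) (hp : 0 < p) (g k : ℤ) (n : ℕ) :
    ∃ (x : ℕ) (e : ℤ),
      (1 + (p : ℤ) ^ 2 * g) ^ x = 1 + p ^ 2 * g * k + p ^ 2 * g * p ^ n * e := by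
  induction n with
  | zero => exact ⟨0, -k, by ring⟩
  | succ n ih =>
    obtain ⟨x, e, hx⟩ := ih
    obtain ⟨c, hc⟩ := exists_one_add_pow_pow_eq p g n
    obtain ⟨t, ht⟩ := Int.eq_ofNat_of_zero_le (Int.emod_nonneg (-e) (b := p) (by positivity))
    have hs := Int.emod_add_mul_ediv (-e) p
    rw [ht] at hs
    set s := (-e) / (p : ℤ)
    obtain ⟨f, hf⟩ := exists_one_add_pow_eq ((p : ℤ) ^ 2 * g * p ^ n * (1 + p * c)) t
    have he : e = -(t + p * s) := by linarith
    refine ⟨x + p ^ n * t, -s + t * c + (p * g * k + p * g * p ^ n * e) * (t * (1 + p * c)) +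
      (1 + p ^ 2 * g * k + p ^ 2 * g * p ^ n * e) * f * p * g * p ^ n * (1 + p * c) ^ 2, ?_⟩
    rw [pow_add, pow_mul, hc, hf, hx, he]
    ring

/-- The number whose base-`q` digits, most significant first, are `w 0, …, w (m - 1)`. -/
def blockValue (q : ℕ) (w : ℕ → ℕ) : ℕ → ℕ
  | 0 => 0
  | m + 1 => q * blockValue q w m + w m

theorem blockValue_lt {q : ℕ} {w : ℕ → ℕ} (hw : ∀ i, w i < q) (m : ℕ) :
    blockValue q w m < q ^ m := by
  induction m with
  | zero => simp [blockValue]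
  | succ m ih =>
    rw [blockValue, pow_succ]
    have := hw m
    nlinarith

theorem eq_of_blockValue_eq {q : ℕ} {v w : ℕ → ℕ} (hv : ∀ i, v i < q) (hw : ∀ i, w i < q)
    {m : ℕ} (h : blockValue q v m = blockValue q w m) : ∀ j < m, v j = w j := by
  induction m with
  | zero => simp
  | succ m ih =>
    have hq : 0 < q := (Nat.zero_le _).trans_lt (hv 0)
    simp only [blockValue] at h
    have h1 := congrArg (· % q) h
    have h2 := congrArg (· / q) h
    simp only [Nat.mul_add_mod, Nat.mod_eq_of_lt (hv m), Nat.mod_eq_of_lt (hw m)] at h1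
    simp only [Nat.mul_add_div hq, Nat.div_eq_of_lt (hv m), Nat.div_eq_of_lt (hw m),
      add_zero] at h2
    intro j hj
    rcases Nat.lt_succ_iff_lt_or_eq.mp hj with hj | rfl
    · exact ih h2 j hj
    · exact h1

theorem pow_mul_ofDigits {q : ℕ} (d : ℕ → Fin q) (m : ℕ) :
    (q : ℝ) ^ m * Real.ofDigits d =
      blockValue q (fun i ↦ d i) m + Real.ofDigits (fun i ↦ d (i + m)) := by
  have hq : (q : ℝ) ≠ 0 := by
    have := (d 0).pos
    positivity
  induction m with
  | zero => simp [blockValue]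
  | succ m ih =>
    have h := Real.ofDigits_eq_sum_add_ofDigits (fun i ↦ d (i + m)) 1
    simp only [Finset.sum_range_one, Real.ofDigitsTerm, zero_add, pow_one] at h
    rw [pow_succ', mul_assoc, ih, h, blockValue]
    have : (fun i ↦ d (i + 1 + m)) = fun i ↦ d (i + (m + 1)) := by
      funext i; congr 1; omega
    rw [this]
    push_cast
    field_simp
    ring

theorem exists_residue_in_interval {q D m P W : ℕ} (hD : 0 < D) (hq : 0 < q)
    (hP : q ^ m * (D + 1) < P) :
    ∃ k : ℕ, W * P < q ^ m * (1 + D * k) ∧ q ^ m * (1 + D * k) < (W + 1) * P := by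
  have hQ : 0 < q ^ m * D := by positivity
  refine ⟨W * P / (q ^ m * D) + 1, ?_, ?_⟩
  · have := Nat.lt_mul_div_succ (W * P) hQ
    nlinarith
  · have := Nat.mul_div_le (W * P) (q ^ m * D)
    nlinarith

/-- If `q ^ i ≡ r` modulo `P` with `0 < r < P`, the expansion of `1 / P` shifted by `i` digits
represents `r / P`. -/
theorem ofDigits_shift_eq {q P i r : ℕ} (d : ℕ → Fin q) (hd : (P : ℝ)⁻¹ = Real.ofDigits d)
    (hr : 0 < r) (hrP : r < P) (h : (q : ℤ) ^ i ≡ r [ZMOD P]) :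
    Real.ofDigits (fun j ↦ d (j + i)) = r / P := by
  obtain ⟨e, he⟩ := h.symm.dvd
  have hP : (0 : ℝ) < P := by exact_mod_cast hr.trans hrP
  have he' : (q : ℝ) ^ i = r + P * e := by
    have : ((q : ℤ) ^ i : ℤ) = r + P * e := by linarith
    exact_mod_cast this
  have h1 := pow_mul_ofDigits d i
  set N := blockValue q (fun i ↦ d i) i
  set t := Real.ofDigits (fun j ↦ d (j + i))
  have ht0 : 0 ≤ t := Real.ofDigits_nonneg _
  have ht1 : t ≤ 1 := Real.ofDigits_le_one _
  rw [← hd, he'] at h1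
  have h2 : (r : ℝ) / P + e = N + t := by
    rw [← h1]; field_simp
  have hr0 : 0 < (r : ℝ) / P := by positivity
  have hr1 : (r : ℝ) / P < 1 := by
    rw [div_lt_one hP]; exact_mod_cast hrP
  have h3 : (e : ℝ) < N + 1 := by linarith
  have h4 : (N : ℝ) < e + 1 := by linarith
  have h3' : e < N + 1 := by exact_mod_cast h3
  have h4' : (N : ℤ) < e + 1 := by exact_mod_cast h4
  have h5 : e = N := by omega
  rw [h5] at h2
  push_cast at h2
  linarith

theorem block_eq_of_ofDigits_mem {q m : ℕ} (d : ℕ → Fin q) {w : ℕ → ℕ} (hw : ∀ i, w i < q)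
    (h1 : (blockValue q w m : ℝ) < q ^ m * Real.ofDigits d)
    (h2 : q ^ m * Real.ofDigits d < (blockValue q w m : ℝ) + 1) :
    ∀ j < m, (d j : ℕ) = w j := by
  rw [pow_mul_ofDigits] at h1 h2
  have ht0 := Real.ofDigits_nonneg (fun i ↦ d (i + m))
  have ht1 := Real.ofDigits_le_one (fun i ↦ d (i + m))
  refine eq_of_blockValue_eq (fun i ↦ (d i).isLt) hw ?_
  have h3 : (blockValue q w m : ℝ) < blockValue q (fun i ↦ d i) m + 1 := by linarith
  have h4 : (blockValue q (fun i ↦ d i) m : ℝ) < blockValue q w m + 1 := by linarith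
  have h3' : blockValue q w m < blockValue q (fun i ↦ d i) m + 1 := by exact_mod_cast h3
  have h4' : blockValue q (fun i ↦ d i) m < blockValue q w m + 1 := by exact_mod_cast h4
  omega

theorem stmt_19 (q p m : ℕ) (hq : 3 ≤ q) (hp : 2 ≤ p) (hpq : Nat.gcd p q = 1)
    (hm : 0 < m) :
    ∃ n0 : ℕ, ∀ n : ℕ, n0 ≤ n →
      ∀ d : ℕ → ℕ, (∀ i, d i < q) →
        ((p : ℝ) ^ n)⁻¹ = ∑' i : ℕ, (d i : ℝ) / (q : ℝ) ^ (i + 1) →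
        ∀ w : Fin m → ℕ, (∀ i, w i < q) →
          ∃ i : ℕ, ∀ j : Fin m, d (i + (j : ℕ)) = w j := by
  have hT : 0 < Nat.totient (p ^ 2) := Nat.totient_pos.mpr (by positivity)
  set T := Nat.totient (p ^ 2)
  have hmod : q ^ T ≡ 1 [MOD p ^ 2] :=
    Nat.ModEq.pow_totient ((Nat.coprime_comm.mp hpq).pow_right 2)
  have hqT : 1 < q ^ T := Nat.one_lt_pow hT.ne' (by omega)
  obtain ⟨g, hg⟩ := (Nat.modEq_iff_dvd' hqT.le).mp hmod.symm
  have hqT' : q ^ T = 1 + p ^ 2 * g := by omega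
  have hD : 0 < p ^ 2 * g := by omega
  refine ⟨q ^ m * (p ^ 2 * g + 1), fun n hn d hd hsum w hw ↦ ?_⟩
  have hP : q ^ m * (p ^ 2 * g + 1) < p ^ n := hn.trans_lt (Nat.lt_pow_self (by omega))
  let d' : ℕ → Fin q := fun i ↦ ⟨d i, hd i⟩
  let w' : ℕ → ℕ := fun i ↦ if h : i < m then w ⟨i, h⟩ else 0
  have hw' : ∀ i, w' i < q := by
    intro i
    simp only [w']
    split_ifs
    · exact hw _
    · omega
  have hd' : ((p ^ n : ℕ) : ℝ)⁻¹ = Real.ofDigits d' := by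
    push_cast
    rw [hsum]
    rfl
  obtain ⟨k, hk1, hk2⟩ := exists_residue_in_interval (W := blockValue q w' m) hD
    (by omega : 0 < q) hP
  obtain ⟨x, e, hx⟩ := exists_pow_eq_one_add_mul p (by omega) g k n
  have hr : 1 + p ^ 2 * g * k < p ^ n := by
    have h := hk2.trans_le (Nat.mul_le_mul_right _ (blockValue_lt hw' m))
    exact Nat.lt_of_mul_lt_mul_left h
  have hcong : (q : ℤ) ^ (T * x) ≡ ((1 + p ^ 2 * g * k : ℕ) : ℤ) [ZMOD (p ^ n : ℕ)] := by
    refine (Int.modEq_iff_dvd.mpr ⟨p ^ 2 * g * e, ?_⟩).symm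
    have h : (q : ℤ) ^ T = 1 + p ^ 2 * g := by exact_mod_cast hqT'
    rw [pow_mul, h, hx]
    push_cast
    ring
  have ht := ofDigits_shift_eq d' hd' (by omega) hr hcong
  have hpn : (0 : ℝ) < (p ^ n : ℕ) := by positivity
  have hblock := block_eq_of_ofDigits_mem (m := m) (fun j ↦ d' (j + T * x)) hw'
    (by rw [ht, mul_div_assoc', lt_div_iff₀ hpn]; exact_mod_cast hk1)
    (by rw [ht, mul_div_assoc', div_lt_iff₀ hpn]; exact_mod_cast hk2)
  refine ⟨T * x, fun j ↦ ?_⟩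
  have h := hblock j j.isLt
  simpa [d', w', add_comm] using h
end
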